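/- arXiv:1409.5923 — 3 statements merged into one kernel-verified Lean document; each statement's English description precedes it below -/
import Mathlib

section
/- Let G = (V,E) be an infinite, connected, locally finite graph, fix γ > 1 and set L_0 = 10000, L_{k+1} = L_k^γ. Let P be a probability measure on {0,1}^V (with the product σ-algebra) and set p_k = sup_{x ∈ V} P[S(x, L_k)]. Suppose that for some χ > 0, some β > γ(1+χ), and some k̄ ≥ 1 with 2000·L_k < L_{k+1} for all k ≥ k̄, one has p_k ≤ L_k^{−β} for all k ≥ k̄. Then P gives probability one to the event that there exists exactly one infinite open cluster. -/
open MeasureTheory Filter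

universe u

variable {V : Type u}

/-- The set of vertices within graph distance `r` of `x`. -/
def gball (G : SimpleGraph V) (x : V) (r : ℝ) : Set V :=
  {y | ∃ p : G.Walk x y, (p.length : ℝ) ≤ r}

/-- The `r`-neighborhood `B(K, r)` of a set `K`. -/
def gnbhd (G : SimpleGraph V) (K : Set V) (r : ℝ) : Set V :=
  {y | ∃ x ∈ K, y ∈ gball G x r}

/-- The edge boundary of `A` relative to `B`, encoded as ordered pairs
`(a, b)` with `a ∈ A`, `b ∈ B \ A` and `a ~ b`. -/
def relBoundary (G : SimpleGraph V) (A B : Set V) : Set (V × V) :=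
  {e | G.Adj e.1 e.2 ∧ e.1 ∈ A ∧ e.2 ∈ B ∧ e.2 ∉ A}

/-- The edge boundary of `A`, encoded as ordered pairs `(a, b)` with
`a ∈ A`, `b ∉ A` and `a ~ b`. -/
def bdry (G : SimpleGraph V) (A : Set V) : Set (V × V) :=
  {e | G.Adj e.1 e.2 ∧ e.1 ∈ A ∧ e.2 ∉ A}

/-- The local isoperimetric inequality `L(dᵢ, cᵢ)`. -/
def LocalIso (G : SimpleGraph V) (di ci : ℝ) : Prop :=
  ∀ (x : V) (r : ℝ), 1 ≤ r → ∀ A : Set V, A ⊆ gball G x r →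
    (A.ncard : ℝ) ≤ (gball G x r).ncard / 2 →
    ci * (A.ncard : ℝ) ^ ((di - 1) / di) ≤ ((relBoundary G A (gball G x r)).ncard : ℝ)

/-- The volume upper bound `𝒱ᵤ(dᵤ, cᵤ)`. -/
def VolUpper (G : SimpleGraph V) (du cu : ℝ) : Prop :=
  ∀ (x : V) (r : ℝ), 1 ≤ r →
    (gball G x r).Finite ∧ ((gball G x r).ncard : ℝ) ≤ cu * r ^ du

/-- The volume lower bound `𝒱ₗ(dₗ, cₗ)`. -/
def VolLower (G : SimpleGraph V) (dl cl : ℝ) : Prop :=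
  ∀ (x : V) (r : ℝ), 1 ≤ r → cl * r ^ dl ≤ ((gball G x r).ncard : ℝ)

/-- Every walk from `y` to `z` has length at least `t`; equivalently the graph
distance from `y` to `z` (with value `∞` if unreachable) is at least `t`. -/
def distGE (G : SimpleGraph V) (y z : V) (t : ℝ) : Prop :=
  ∀ p : G.Walk y z, t ≤ (p.length : ℝ)

/-- The distance between the sets `A` and `B` is at least `t`. -/
def setDistGE (G : SimpleGraph V) (A B : Set V) (t : ℝ) : Prop :=
  ∀ a ∈ A, ∀ b ∈ B, distGE G a b t

/-- The diameter of `A` is at least `t`. -/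
def diamGE (G : SimpleGraph V) (A : Set V) (t : ℝ) : Prop :=
  ∃ y ∈ A, ∃ z ∈ A, distGE G y z t

/-- The diameter of `A` is at most `t`. -/
def diamLE (G : SimpleGraph V) (A : Set V) (t : ℝ) : Prop :=
  ∀ y ∈ A, ∀ z ∈ A, ∃ p : G.Walk y z, (p.length : ℝ) ≤ t

/-- `A` is a connected set of vertices. -/
def ConnSet (G : SimpleGraph V) (A : Set V) : Prop := (G.induce A).Connected

/-- There is an open path, all of whose vertices lie in `S`, connecting `A` to `A'`:
its first vertex lies in `B(A,1)` and its last vertex in `B(A',1)`. -/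
def ConnectsIn (G : SimpleGraph V) (ω : V → Bool) (A A' S : Set V) : Prop :=
  ∃ (a b : V) (p : G.Walk a b), a ∈ gnbhd G A 1 ∧ b ∈ gnbhd G A' 1 ∧
    (∀ v ∈ p.support, v ∈ S) ∧ (∀ v ∈ p.support, ω v = true)

/-- The separation event `𝒮(x, L)`. -/
def sep (G : SimpleGraph V) (ω : V → Bool) (x : V) (L : ℝ) : Prop :=
  ∃ A B : Set V, A ⊆ gball G x (3 * L / 6) ∧ B ⊆ gball G x (3 * L / 6) ∧
    ConnSet G A ∧ ConnSet G B ∧ setDistGE G A B 2 ∧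
    diamGE G A (L / 100) ∧ diamGE G B (L / 100) ∧
    ¬ ConnectsIn G ω A B (gball G x L)

/-- The open cluster `𝒞ₓ` of `x` (empty when `x` is closed). -/
def openCluster (G : SimpleGraph V) (ω : V → Bool) (x : V) : Set V :=
  {y | ω x = true ∧ ∃ p : G.Walk x y, ∀ v ∈ p.support, ω v = true}

/-- There is exactly one infinite open cluster. -/
def UniqueInfCluster (G : SimpleGraph V) (ω : V → Bool) : Prop :=
  (∃ x, (openCluster G ω x).Infinite) ∧
    ∀ x y, (openCluster G ω x).Infinite → (openCluster G ω y).Infinite →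
      openCluster G ω x = openCluster G ω y

/-- `P` is the Bernoulli product measure on `{0,1}^V` with parameter `p`, characterized by
its values on cylinder events. -/
def IsBernoulli (P : Measure (V → Bool)) (p : ℝ) : Prop :=
  ∀ (F : Finset V) (η : V → Bool),
    P {ω | ∀ x ∈ F, ω x = η x} =
      ENNReal.ofReal (p ^ (F.filter fun x => η x = true).card *
        (1 - p) ^ (F.filter fun x => η x = false).card)

/-- A decreasing event. -/
def DecreasingEvent (E : Set (V → Bool)) : Prop :=
  ∀ ω ∈ E, ∀ ω' : V → Bool, (∀ x, ω' x ≤ ω x) → ω' ∈ E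

/-- The σ-algebra `σ(Y_z ; z ∈ S)` generated by the coordinates in `S`. -/
def cylσ (S : Set V) : MeasurableSpace (V → Bool) :=
  MeasurableSpace.comap (fun ω => S.restrict ω) MeasurableSpace.pi

/-- The decoupling inequality `𝒟(α, c_α)`. -/
def Decoupling (G : SimpleGraph V) (P : Measure (V → Bool)) (α cα : ℝ) : Prop :=
  ∀ (x : V) (r : ℝ), 1 ≤ r → ∀ E E' : Set (V → Bool),
    DecreasingEvent E → DecreasingEvent E' →
    MeasurableSet[cylσ (gball G x r)] E →
    MeasurableSet[cylσ (gball G x (2 * r))ᶜ] E' →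
    P (E ∩ E') ≤ P E * P E' + ENNReal.ofReal (cα * r ^ (-α))

/-- The scales `L₀ = 10000`, `L_{k+1} = L_k ^ γ`. -/
noncomputable def Lseq (γ : ℝ) : ℕ → ℝ
  | 0 => 10000
  | k + 1 => Lseq γ k ^ γ

section helpers

variable {W : Type u} {G : SimpleGraph W}

lemma mem_gball_iff (hG : G.Connected) {x y : W} {r : ℝ} :
    y ∈ gball G x r ↔ (G.dist x y : ℝ) ≤ r := by
  constructor
  · rintro ⟨p, hp⟩
    have h : (G.dist x y : ℝ) ≤ p.length := by exact_mod_cast SimpleGraph.dist_le p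
    linarith
  · intro h
    obtain ⟨p, hp⟩ := hG.exists_walk_length_eq_dist x y
    exact ⟨p, by rw [hp]; exact h⟩

lemma distGE_of_le {x y : W} {t : ℝ} (h : t ≤ (G.dist x y : ℝ)) : distGE G x y t := by
  intro p
  have h : (G.dist x y : ℝ) ≤ p.length := by exact_mod_cast SimpleGraph.dist_le p
  linarith

lemma dtri (hG : G.Connected) (x y z : W) :
    (G.dist x z : ℝ) ≤ G.dist x y + G.dist y z := by
  exact_mod_cast hG.dist_triangle

lemma dcomm (x y : W) : (G.dist x y : ℝ) = G.dist y x := by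
  rw [SimpleGraph.dist_comm]

lemma noSep_conn (hG : G.Connected) {ω : W → Bool} {z : W} {L : ℝ} (hS : ¬ sep G ω z L)
    {a a' b b' : W} (p : G.Walk a a') (q : G.Walk b b')
    (hp : ∀ v ∈ p.support, (G.dist z v : ℝ) ≤ L / 2)
    (hq : ∀ v ∈ q.support, (G.dist z v : ℝ) ≤ L / 2)
    (hpd : L / 100 ≤ (G.dist a a' : ℝ)) (hqd : L / 100 ≤ (G.dist b b' : ℝ))
    (hpq : ∀ u ∈ p.support, ∀ v ∈ q.support, (2 : ℝ) ≤ G.dist u v) :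
    ∃ (e f : W) (r : G.Walk e f), (∀ v ∈ r.support, ω v = true) ∧
      (∃ u ∈ p.support, (G.dist u e : ℝ) ≤ 1) ∧ (∃ u ∈ q.support, (G.dist u f : ℝ) ≤ 1) := by
  by_contra hcon
  apply hS
  refine ⟨{v | v ∈ p.support}, {v | v ∈ q.support}, ?_, ?_, p.connected_induce_support,
    q.connected_induce_support, ?_, ?_, ?_, ?_⟩
  · intro v hv
    rw [mem_gball_iff hG]
    have := hp v hv
    linarith
  · intro v hv
    rw [mem_gball_iff hG]
    have := hq v hv
    linarith
  · intro u hu v hv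
    exact distGE_of_le (hpq u hu v hv)
  · exact ⟨a, p.start_mem_support, a', p.end_mem_support, distGE_of_le hpd⟩
  · exact ⟨b, q.start_mem_support, b', q.end_mem_support, distGE_of_le hqd⟩
  · rintro ⟨e, f, r, ⟨u, hu, hue⟩, ⟨v, hv, hvf⟩, -, hr⟩
    rw [mem_gball_iff hG] at hue hvf
    exact hcon ⟨e, f, r, hr, ⟨u, hu, hue⟩, ⟨v, hv, hvf⟩⟩

lemma trunc (hG : G.Connected) (r : ℝ) {c b : W} (p : G.Walk c b) :
    (∀ v ∈ p.support, (G.dist v b : ℝ) < r) ∨ ∃ (c' : W) (q : G.Walk c' b),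
      (∀ v ∈ q.support, v ∈ p.support) ∧ (∀ v ∈ q.support, (G.dist v b : ℝ) ≤ r ⊔ 0 + 1) ∧
      r ≤ G.dist c' b := by
  induction p with
  | nil =>
    rename_i u
    by_cases h : (0 : ℝ) < r
    · left; intro v hv; simp at hv; subst hv; simpa using h
    · right
      refine ⟨u, .nil, fun v hv => hv, ?_, by simpa using h⟩
      intro v hv; simp at hv; subst hv; simp
      positivity
  | @cons c d b h p ih =>
    rcases ih with ih | ⟨c', q, h1, h2, h3⟩
    · by_cases hc : (G.dist c b : ℝ) < r
      · left
        intro v hv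
        rw [SimpleGraph.Walk.support_cons, List.mem_cons] at hv
        rcases hv with rfl | hv
        · exact hc
        · exact ih v hv
      · right
        refine ⟨c, .cons h p, fun v hv => hv, ?_, not_lt.1 hc⟩
        intro v hv
        rw [SimpleGraph.Walk.support_cons, List.mem_cons] at hv
        have hl := le_max_left r 0
        rcases hv with rfl | hv
        · have h1 := dtri hG v d b
          have h2 := ih d p.start_mem_support
          have h3 : (G.dist v d : ℝ) = 1 := by
            exact_mod_cast SimpleGraph.dist_eq_one_iff_adj.2 h
          linarith
        · have := ih v hv
          linarith
    · right
      refine ⟨c', q, fun v hv => ?_, h2, h3⟩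
      rw [SimpleGraph.Walk.support_cons, List.mem_cons]
      exact Or.inr (h1 v hv)

lemma oc_symm {ω : W → Bool} {x y : W} (h : y ∈ openCluster G ω x) : x ∈ openCluster G ω y := by
  obtain ⟨hx, p, hp⟩ := h
  exact ⟨hp y p.end_mem_support, p.reverse, by simpa using hp⟩

lemma oc_trans {ω : W → Bool} {x y z : W} (h : y ∈ openCluster G ω x)
    (h' : z ∈ openCluster G ω y) : z ∈ openCluster G ω x := by
  obtain ⟨hx, p, hp⟩ := h
  obtain ⟨hy, q, hq⟩ := h'
  refine ⟨hx, p.append q, ?_⟩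
  intro v hv
  rw [SimpleGraph.Walk.mem_support_append_iff] at hv
  rcases hv with hv | hv
  · exact hp v hv
  · exact hq v hv

lemma oc_near (hG : G.Connected) {ω : W → Bool} {x y z : W} (h : y ∈ openCluster G ω x)
    (hz : ω z = true) (hd : (G.dist y z : ℝ) ≤ 1) : z ∈ openCluster G ω x := by
  have hy := (oc_symm h).1
  obtain ⟨q, hq⟩ := hG.exists_walk_length_eq_dist y z
  have hd' : G.dist y z ≤ 1 := by exact_mod_cast hd
  refine oc_trans h ⟨hy, ?_⟩
  rcases Nat.lt_or_ge (G.dist y z) 1 with h0 | h0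
  · have : y = z := hG.dist_eq_zero_iff.1 (by omega)
    subst this
    exact ⟨.nil, by simpa using hy⟩
  · have ha : G.Adj y z := SimpleGraph.dist_eq_one_iff_adj.1 (le_antisymm hd' h0)
    exact ⟨ha.toWalk, by simp [hy, hz]⟩

/-- truncated open walk at a vertex of the cluster -/
lemma oc_trunc (hG : G.Connected) {ω : W → Bool} {y b c : W} {r : ℝ} (hr : 0 ≤ r)
    (hb : b ∈ openCluster G ω y) (hc : c ∈ openCluster G ω y) (hd : r ≤ G.dist b c) :
    ∃ (c' : W) (q : G.Walk c' b), (∀ v ∈ q.support, v ∈ openCluster G ω y) ∧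
      (∀ v ∈ q.support, (G.dist v b : ℝ) ≤ r + 1) ∧ r ≤ G.dist c' b := by
  classical
  obtain ⟨hco, p, hp⟩ := oc_trans (oc_symm hc) hb
  rcases trunc hG r p with h | ⟨c', q, h1, h2, h3⟩
  · have := h c p.start_mem_support
    rw [dcomm] at this
    linarith
  · refine ⟨c', q, fun v hv => ?_, ?_, h3⟩
    · refine oc_trans hc ⟨hco, p.takeUntil v (h1 v hv), fun w hw => hp w ?_⟩
      exact p.support_takeUntil_subset_support (h1 v hv) hw
    · rwa [max_eq_left hr] at h2

/-- geodesic segments -/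
def Geo (G : SimpleGraph W) (x : ℕ → W) (N : ℕ) : Prop :=
  (∀ i < N, G.Adj (x i) (x (i + 1))) ∧
    ∀ i j, i ≤ j → j ≤ N → (G.dist (x i) (x j) : ℝ) = (j : ℝ) - i

lemma seg {x : ℕ → W} {N : ℕ} (hx : Geo G x N) (i j : ℕ) (hij : i ≤ j) (hj : j ≤ N) :
    ∃ q : G.Walk (x i) (x j), ∀ v ∈ q.support, ∃ m, i ≤ m ∧ m ≤ j ∧ v = x m := by
  induction j, hij using Nat.le_induction with
  | base => exact ⟨.nil, fun v hv => ⟨i, le_rfl, le_rfl, by simpa using hv⟩⟩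
  | succ j hij ih =>
    obtain ⟨q, hq⟩ := ih (by omega)
    refine ⟨q.concat (hx.1 j (by omega)), fun v hv => ?_⟩
    rw [SimpleGraph.Walk.support_concat] at hv
    simp at hv
    rcases hv with hv | rfl
    · obtain ⟨m, h1, h2, h3⟩ := hq v hv
      exact ⟨m, h1, by omega, h3⟩
    · exact ⟨j + 1, by omega, le_rfl, rfl⟩

lemma ball_finite (hG : G.Connected) (hlf : ∀ v : W, (G.neighborSet v).Finite) (o : W) (n : ℕ) :
    {v | G.dist o v ≤ n}.Finite := by
  induction n with
  | zero =>
    refine (Set.finite_singleton o).subset ?_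
    intro v hv
    have : o = v := hG.dist_eq_zero_iff.1 (by simpa using hv)
    simp [this]
  | succ n ih =>
    refine (ih.union (ih.biUnion (fun u _ => hlf u))).subset ?_
    intro v hv
    by_cases h : G.dist o v ≤ n
    · exact Or.inl h
    · right
      obtain ⟨p, hp⟩ := hG.exists_walk_length_eq_dist o v
      have hv' : G.dist o v ≤ n + 1 := hv
      have hl : p.length = n + 1 := by omega
      have ha := p.adj_getVert_succ (i := n) (by omega)
      rw [← hl, p.getVert_length] at ha
      refine Set.mem_biUnion (x := p.getVert n) ?_ ha
      have := SimpleGraph.dist_le (p.take n)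
      simp at this
      exact this.1

lemma exists_far (hG : G.Connected) (hlf : ∀ v : W, (G.neighborSet v).Finite) (o : W)
    {S : Set W} (hS : S.Infinite) (r : ℝ) : ∃ v ∈ S, r ≤ G.dist o v := by
  by_contra! h
  refine hS ((ball_finite hG hlf o ⌈r⌉₊).subset ?_)
  intro v hv
  have h1 := h v hv
  have h2 := Nat.le_ceil r
  have : (G.dist o v : ℝ) ≤ ⌈r⌉₊ := by linarith
  exact_mod_cast this

lemma exists_geo [Infinite W] (hG : G.Connected) (hlf : ∀ v : W, (G.neighborSet v).Finite) (o : W)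
    (N : ℕ) : ∃ x : ℕ → W, x 0 = o ∧ Geo G x N := by
  obtain ⟨v, -, hv⟩ := exists_far hG hlf o (Set.infinite_univ) (N : ℝ)
  have hv : N ≤ G.dist o v := by exact_mod_cast hv
  obtain ⟨p, hp⟩ := hG.exists_walk_length_eq_dist o v
  have hup : ∀ i j, i ≤ j → j ≤ p.length → G.dist (p.getVert i) (p.getVert j) ≤ j - i := by
    intro i j hij
    induction j, hij using Nat.le_induction with
    | base => intro _; simp
    | succ j hij ih =>
      intro hj
      have h1 := ih (by omega)
      have h2 := SimpleGraph.dist_eq_one_iff_adj.2 (p.adj_getVert_succ (i := j) (by omega))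
      have h3 := hG.dist_triangle (u := p.getVert i) (v := p.getVert j) (w := p.getVert (j + 1))
      omega
  refine ⟨p.getVert, p.getVert_zero, fun i hi => p.adj_getVert_succ (by omega), ?_⟩
  intro i j hij hj
  have h1 := hup 0 i (by omega) (by omega)
  have h2 := hup i j hij (by omega)
  have h3 := hup j p.length (by omega) le_rfl
  rw [p.getVert_zero] at h1
  rw [p.getVert_length] at h3
  have t1 := hG.dist_triangle (u := o) (v := p.getVert i) (w := v)
  have t2 := hG.dist_triangle (u := p.getVert i) (v := p.getVert j) (w := v)
  have : G.dist (p.getVert i) (p.getVert j) = j - i := by omega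
  rw [this, Nat.cast_sub hij]

/-- one jump along the geodesic. -/
lemma jump (hG : G.Connected) {ω : W → Bool} {x : ℕ → W} {N : ℕ} (hx : Geo G x N)
    {L : ℝ} (hL : 10000 ≤ L) {n : ℕ} (hN : (n : ℝ) + L / 5 + 1 ≤ N) (hS : ¬ sep G ω (x n) L)
    {y b c : W} (hb : b ∈ openCluster G ω y) (hc : c ∈ openCluster G ω y)
    (hbc : L / 100 ≤ G.dist b c) (hbn : (G.dist b (x n) : ℝ) ≤ L / 50) :
    ∃ j : ℕ, n + 1 ≤ j ∧ (j : ℝ) ≤ n + L / 2 ∧ ∃ b' ∈ openCluster G ω y,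
      (G.dist b' (x j) : ℝ) ≤ L / 50 ∧ L / 100 ≤ G.dist b' b := by
  obtain ⟨c', p, hp1, hp2, hp3⟩ := oc_trunc hG (by linarith) hb hc hbc
  have e1 := Nat.le_ceil (L / 10)
  have e2 := Nat.ceil_lt_add_one (show 0 ≤ L / 10 by linarith)
  have e3 := Nat.le_ceil (L / 5)
  have e4 := Nat.ceil_lt_add_one (show 0 ≤ L / 5 by linarith)
  set i1 := ⌈L / 10⌉₊
  set i2 := ⌈L / 5⌉₊
  have h12 : i1 ≤ i2 := Nat.ceil_le_ceil (by linarith)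
  have hi2 : n + i2 ≤ N := by
    have : ((n + i2 : ℕ) : ℝ) ≤ N := by push_cast; linarith
    exact_mod_cast this
  obtain ⟨q, hq⟩ := seg hx (n + i1) (n + i2) (by omega) hi2
  have hq' : ∀ v ∈ q.support, ∃ m : ℕ, n + i1 ≤ m ∧ (n : ℝ) + L / 10 ≤ m ∧
      (m : ℝ) ≤ n + L / 5 + 1 ∧ v = x m ∧ (G.dist (x n) v : ℝ) = m - n := by
    intro v hv
    obtain ⟨m, h1, h2, h3⟩ := hq v hv
    have h1' : (n : ℝ) + i1 ≤ m := by exact_mod_cast h1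
    have h2' : (m : ℝ) ≤ n + i2 := by exact_mod_cast h2
    refine ⟨m, h1, by linarith, by linarith, h3, ?_⟩
    rw [h3]
    exact hx.2 n m (by omega) (by omega)
  obtain ⟨e, f, r, hr, ⟨u, hu, hue⟩, ⟨v, hv, hvf⟩⟩ := noSep_conn hG hS p q
    (by
      intro v hv
      have := hp2 v hv
      have := dtri hG (x n) b v
      rw [dcomm (x n) b, dcomm b v] at this
      linarith)
    (by
      intro v hv
      obtain ⟨m, -, h1, h2, -, h4⟩ := hq' v hv
      linarith)
    hp3
    (by
      rw [hx.2 (n + i1) (n + i2) (by omega) hi2]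
      push_cast
      linarith)
    (by
      intro u hu v hv
      have a1 := hp2 u hu
      obtain ⟨m, -, h1, h2, -, h4⟩ := hq' v hv
      have a2 := dtri hG (x n) b v
      have a3 := dtri hG b u v
      rw [dcomm (x n) b] at a2
      rw [dcomm b u] at a3
      linarith)
  obtain ⟨m, h0, h1, h2, h3, h4⟩ := hq' v hv
  have he := oc_near hG (hp1 u hu) (hr e r.start_mem_support) hue
  have hf : f ∈ openCluster G ω y := oc_trans he ⟨hr e r.start_mem_support, r, hr⟩
  have : 1 ≤ i1 := Nat.ceil_pos.2 (by linarith)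
  refine ⟨m, by omega, by linarith, f, hf, ?_, ?_⟩
  · rw [← h3, dcomm]; linarith
  · have a1 := dtri hG (x n) b f
    have a2 := dtri hG (x n) f v
    rw [dcomm (x n) b, dcomm b f] at a1
    rw [dcomm f v] at a2
    linarith

lemma climb (hG : G.Connected) {ω : W → Bool} {x : ℕ → W} {N : ℕ} (hx : Geo G x N)
    {L M : ℝ} (hL : 10000 ≤ L) (hM : 2000 * L < M) (hN : M ≤ N)
    (hS : ∀ i : ℕ, (i : ℝ) ≤ M → ¬ sep G ω (x i) L)
    {b c : W} (hb : b ∈ openCluster G ω b) (hc : c ∈ openCluster G ω b)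
    (hbc : L / 100 ≤ G.dist b c) (hbn : (G.dist b (x 0) : ℝ) ≤ L / 50) :
    ∃ c' ∈ openCluster G ω b, M / 100 ≤ G.dist b c' := by
  have key : ∀ n : ℕ, (n : ℝ) ≤ M / 25 + 1 → ∃ j : ℕ, n ≤ j ∧ (j : ℝ) ≤ n + L / 2 ∧
      ∃ b' ∈ openCluster G ω b, (G.dist b' (x j) : ℝ) ≤ L / 50 ∧
        ∃ c' ∈ openCluster G ω b, L / 100 ≤ G.dist b' c' := by
    intro n
    induction n with
    | zero =>
      intro _
      exact ⟨0, le_rfl, by push_cast; linarith, b, hb, hbn, c, hc, hbc⟩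
    | succ n ih =>
      intro hn
      push_cast at hn
      obtain ⟨j, h1, h2, b', hb', h3, c', hc', h4⟩ := ih (by linarith)
      rcases Nat.lt_or_ge n j with hj | hj
      · exact ⟨j, hj, by push_cast; linarith, b', hb', h3, c', hc', h4⟩
      · have : j = n := by omega
        subst this
        obtain ⟨i, i1, i2, b2, hb2, i3, i4⟩ :=
          jump hG hx hL (by linarith) (hS j (by linarith)) hb' hc' h4 h3
        exact ⟨i, i1, by push_cast; linarith, b2, hb2, i3, b', hb', i4⟩
  have e1 := Nat.le_ceil (M / 25)
  have e2 := Nat.ceil_lt_add_one (show 0 ≤ M / 25 by linarith)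
  obtain ⟨j, h1, h2, b', hb', h3, -⟩ := key ⌈M / 25⌉₊ e2.le
  have h1' : (⌈M / 25⌉₊ : ℝ) ≤ j := by exact_mod_cast h1
  refine ⟨b', hb', ?_⟩
  have hj : (j : ℝ) ≤ N := by linarith
  have d1 := hx.2 0 j (by omega) (by exact_mod_cast hj)
  have d2 := dtri hG (x 0) b (x j)
  have d3 := dtri hG b b' (x j)
  rw [dcomm (x 0) b] at d2
  push_cast at d1
  linarith

lemma base (hG : G.Connected) {ω : W → Bool} {x : ℕ → W} {N : ℕ} (hx : Geo G x N)
    {L : ℝ} (hL : 10000 ≤ L) (hN : L ≤ N) (hS : ¬ sep G ω (x 0) L) :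
    ∃ b, b ∈ openCluster G ω b ∧ ∃ c ∈ openCluster G ω b, L / 100 ≤ G.dist b c ∧
      (G.dist b (x 0) : ℝ) ≤ L / 50 := by
  have e1 := Nat.le_ceil (L / 10)
  have e2 := Nat.ceil_lt_add_one (show 0 ≤ L / 10 by linarith)
  have e3 := Nat.le_ceil (L / 5)
  have e4 := Nat.ceil_lt_add_one (show 0 ≤ L / 5 by linarith)
  have e5 := Nat.le_ceil (L / 100)
  have e6 := Nat.ceil_lt_add_one (show 0 ≤ L / 100 by linarith)
  set i1 := ⌈L / 10⌉₊
  set i2 := ⌈L / 5⌉₊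
  set i0 := ⌈L / 100⌉₊
  have h12 : i1 ≤ i2 := Nat.ceil_le_ceil (by linarith)
  have h01 : i0 ≤ i1 := Nat.ceil_le_ceil (by linarith)
  have hi2 : i2 ≤ N := by
    have : (i2 : ℝ) ≤ N := by linarith
    exact_mod_cast this
  obtain ⟨q, hq⟩ := seg hx i1 i2 (by omega) hi2
  obtain ⟨p, hp⟩ := seg hx 0 i0 (by omega) (by omega)
  have hp' : ∀ v ∈ p.support, (G.dist (x 0) v : ℝ) ≤ L / 100 + 1 := by
    intro v hv
    obtain ⟨m, h1, h2, rfl⟩ := hp v hv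
    have h2' : (m : ℝ) ≤ i0 := by exact_mod_cast h2
    rw [hx.2 0 m (by omega) (by omega)]
    push_cast; linarith
  have hq' : ∀ v ∈ q.support, L / 10 ≤ (G.dist (x 0) v : ℝ) ∧ (G.dist (x 0) v : ℝ) ≤ L / 5 + 1 := by
    intro v hv
    obtain ⟨m, h1, h2, rfl⟩ := hq v hv
    have h1' : (i1 : ℝ) ≤ m := by exact_mod_cast h1
    have h2' : (m : ℝ) ≤ i2 := by exact_mod_cast h2
    rw [hx.2 0 m (by omega) (by omega)]
    push_cast; constructor <;> linarith
  obtain ⟨e, f, r, hr, ⟨u, hu, hue⟩, ⟨v, hv, hvf⟩⟩ := noSep_conn hG hS p q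
    (by intro v hv; have := hp' v hv; linarith)
    (by intro v hv; have := (hq' v hv).2; linarith)
    (by rw [hx.2 0 i0 (by omega) (by omega)]; push_cast; linarith)
    (by rw [hx.2 i1 i2 (by omega) hi2]; linarith)
    (by
      intro u hu v hv
      have := hp' u hu
      have := (hq' v hv).1
      have := dtri hG (x 0) u v
      linarith)
  have ho := hr e r.start_mem_support
  have a1 := hp' u hu
  have a2 := (hq' v hv).1
  have a3 := dtri hG (x 0) u e
  have a4 := dtri hG (x 0) f v
  have a5 := dtri hG (x 0) e f
  rw [dcomm f v] at a4
  refine ⟨e, ⟨ho, .nil, by simpa using ho⟩, f, ⟨ho, r, hr⟩, by linarith, ?_⟩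
  rw [dcomm]; linarith

lemma oc_eq {ω : W → Bool} {x y z : W} (h : z ∈ openCluster G ω x)
    (h' : z ∈ openCluster G ω y) : openCluster G ω x = openCluster G ω y := by
  ext w
  exact ⟨fun hw => oc_trans h' (oc_trans (oc_symm h) hw),
    fun hw => oc_trans h (oc_trans (oc_symm h') hw)⟩

lemma uniq (hG : G.Connected) (hlf : ∀ v : W, (G.neighborSet v).Finite) {ω : W → Bool} {o : W}
    {L : ℝ} (hL : 10000 ≤ L) (hS : ¬ sep G ω o L) {x y : W}
    (hx : (openCluster G ω x).Infinite) (hy : (openCluster G ω y).Infinite)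
    (hox : (G.dist o x : ℝ) ≤ L / 10) (hoy : (G.dist o y : ℝ) ≤ L / 10) :
    openCluster G ω x = openCluster G ω y := by
  obtain ⟨c, hc, hcd⟩ := exists_far hG hlf x hx (L / 100)
  obtain ⟨d, hd, hdd⟩ := exists_far hG hlf y hy (L / 100)
  have hxx := oc_trans hc (oc_symm hc)
  have hyy := oc_trans hd (oc_symm hd)
  obtain ⟨c', p, hp1, hp2, hp3⟩ := oc_trunc hG (by linarith) hxx hc hcd
  obtain ⟨d', q, hq1, hq2, hq3⟩ := oc_trunc hG (by linarith) hyy hd hdd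
  by_contra hne
  obtain ⟨e, f, r, hr, ⟨u, hu, hue⟩, ⟨v, hv, hvf⟩⟩ := noSep_conn hG hS p q
    (by
      intro v hv
      have := hp2 v hv
      have := dtri hG o x v
      rw [dcomm x v] at this
      linarith)
    (by
      intro v hv
      have := hq2 v hv
      have := dtri hG o y v
      rw [dcomm y v] at this
      linarith)
    hp3 hq3
    (by
      intro u hu v hv
      by_contra hlt
      have h2 : G.dist u v < 2 := by exact_mod_cast (not_le.1 hlt)
      have h3 : (G.dist u v : ℝ) ≤ 1 := by exact_mod_cast (Nat.lt_succ_iff.1 h2)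
      exact hne (oc_eq (oc_near hG (hp1 u hu) (oc_symm (hq1 v hv)).1 h3) (hq1 v hv)))
  have he := oc_near hG (hp1 u hu) (hr e r.start_mem_support) hue
  have hf := oc_near hG (hq1 v hv) (hr f r.end_mem_support) hvf
  exact hne (oc_eq (oc_trans he ⟨hr e r.start_mem_support, r, hr⟩) hf)

lemma Lseq_ge {γ : ℝ} (hγ : 1 < γ) (k : ℕ) : 10000 ≤ Lseq γ k := by
  induction k with
  | zero => simp [Lseq]
  | succ k ih =>
    have : Lseq γ k ^ (1 : ℝ) ≤ Lseq γ k ^ γ :=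
      Real.rpow_le_rpow_of_exponent_le (by linarith) hγ.le
    rw [Real.rpow_one] at this
    simp only [Lseq]
    linarith

lemma Lseq_grow {γ : ℝ} (hγ : 1 < γ) {kbar : ℕ}
    (hscale : ∀ k, kbar ≤ k → 2000 * Lseq γ k < Lseq γ (k + 1)) (k m : ℕ) (hk : kbar ≤ k) :
    2 ^ m * Lseq γ k ≤ Lseq γ (k + m) := by
  induction m with
  | zero => simp
  | succ m ih =>
    have h1 := hscale (k + m) (by omega)
    have h2 := Lseq_ge hγ (k + m)
    rw [← add_assoc, pow_succ]
    linarith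

lemma determ [Infinite W] (hG : G.Connected) (hlf : ∀ v : W, (G.neighborSet v).Finite)
    {γ : ℝ} (hγ : 1 < γ) {kbar : ℕ}
    (hscale : ∀ k, kbar ≤ k → 2000 * Lseq γ k < Lseq γ (k + 1)) {ω : W → Bool} {o : W}
    (x : ℕ → ℕ → W) (hx0 : ∀ k, x k 0 = o) (hx : ∀ k, Geo G (x k) ⌈Lseq γ (k + 1)⌉₊)
    {k0 : ℕ} (hk0 : kbar ≤ k0)
    (hS : ∀ k, k0 ≤ k → ∀ i : ℕ, (i : ℝ) ≤ Lseq γ (k + 1) → ¬ sep G ω (x k i) (Lseq γ k)) :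
    UniqueInfCluster G ω := by
  have hge := Lseq_ge hγ
  constructor
  · have hs := hscale k0 hk0
    have hz := hS k0 le_rfl 0 (by have := hge (k0 + 1); push_cast; linarith)
    obtain ⟨b, hb, c, hc, hbc, hbo⟩ := base hG (hx k0) (hge k0)
      (by have := Nat.le_ceil (Lseq γ (k0 + 1)); have := hge k0; linarith) hz
    rw [hx0] at hbo
    have ext : ∀ m, ∃ c ∈ openCluster G ω b, Lseq γ (k0 + m) / 100 ≤ G.dist b c := by
      intro m
      induction m with
      | zero => exact ⟨c, hc, hbc⟩
      | succ m ih =>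
        obtain ⟨c, hc, hbc⟩ := ih
        have hg := Lseq_grow hγ hscale k0 m hk0
        have h1 : (1 : ℝ) ≤ 2 ^ m := one_le_pow₀ (by norm_num)
        have h2 : Lseq γ k0 ≤ 2 ^ m * Lseq γ k0 :=
          le_mul_of_one_le_left (by have := hge k0; linarith) h1
        exact climb hG (hx (k0 + m)) (hge _) (hscale _ (by omega)) (Nat.le_ceil _)
          (hS (k0 + m) (by omega)) hb hc hbc (by rw [hx0]; linarith)
    refine ⟨b, fun hfin => ?_⟩
    obtain ⟨R, hR⟩ := (hfin.image (fun v => (G.dist b v : ℝ))).bddAbove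
    obtain ⟨m, hm⟩ := pow_unbounded_of_one_lt R (one_lt_two)
    obtain ⟨c, hc, hbc⟩ := ext m
    have h1 : (G.dist b c : ℝ) ≤ R := hR ⟨c, hc, rfl⟩
    have hg := Lseq_grow hγ hscale k0 m hk0
    have hp : (0 : ℝ) < 2 ^ m := by positivity
    nlinarith [hge k0]
  · intro y z hy hz
    obtain ⟨m, hm⟩ := pow_unbounded_of_one_lt ((G.dist o y : ℝ) + G.dist o z) (one_lt_two)
    have hg := Lseq_grow hγ hscale k0 m hk0
    have hp : (0 : ℝ) < 2 ^ m := by positivity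
    have hS' := hS (k0 + m) (by omega) 0 (by have := hge (k0 + m + 1); push_cast; linarith)
    rw [hx0] at hS'
    have h1 : (0 : ℝ) ≤ G.dist o y := by positivity
    have h2 : (0 : ℝ) ≤ G.dist o z := by positivity
    exact uniq hG hlf (hge _) hS' hy hz (by nlinarith [hge k0]) (by nlinarith [hge k0])

end helpers

/-- if the probabilities of the separation events decay like
`p_k ≤ L_k^{-β}` with `β > γ(1+χ)`, then `P`-a.s. there is exactly one infinite open
cluster. -/
theorem statement10 {V : Type u} (G : SimpleGraph V) [Infinite V] (hconn : G.Connected)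
    (hlf : ∀ v : V, (G.neighborSet v).Finite) (γ : ℝ) (hγ : 1 < γ)
    (P : Measure (V → Bool)) [IsProbabilityMeasure P]
    (χ β : ℝ) (hχ : 0 < χ) (hβ : γ * (1 + χ) < β)
    (kbar : ℕ) (hkbar : 1 ≤ kbar)
    (hscale : ∀ k, kbar ≤ k → 2000 * Lseq γ k < Lseq γ (k + 1))
    (hpk : ∀ k, kbar ≤ k →
      ⨆ x : V, P {ω | sep G ω x (Lseq γ k)} ≤ ENNReal.ofReal (Lseq γ k ^ (-β))) :
    P {ω | UniqueInfCluster G ω} = 1 := by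
  obtain ⟨o⟩ := hconn.nonempty
  choose x hx0 hx using fun k : ℕ => exists_geo hconn hlf o ⌈Lseq γ (k + 1)⌉₊
  have hge := Lseq_ge hγ
  set s : ℕ → Set (V → Bool) := fun m =>
    ⋃ i ∈ Finset.range (⌊Lseq γ (kbar + m + 1)⌋₊ + 1),
      {ω | sep G ω (x (kbar + m) i) (Lseq γ (kbar + m))} with hs
  have hδ : 0 < β - γ := by nlinarith
  set ρ : ℝ := (2 : ℝ) ^ (-(β - γ)) with hρ
  have hρ0 : 0 < ρ := by positivity
  have hρ1 : ρ < 1 := Real.rpow_lt_one_of_one_lt_of_neg (by norm_num) (by linarith)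
  have hbound : ∀ m, P (s m) ≤ ENNReal.ofReal (2 * ρ ^ m) := by
    intro m
    set L := Lseq γ (kbar + m) with hLdef
    have hL : 10000 ≤ L := hge _
    have hL1 : Lseq γ (kbar + m + 1) = L ^ γ := rfl
    have hLγ : 10000 ≤ L ^ γ := hL1 ▸ hge _
    have h1 : P (s m) ≤ ∑ i ∈ Finset.range (⌊L ^ γ⌋₊ + 1), ENNReal.ofReal (L ^ (-β)) := by
      refine (measure_biUnion_finset_le _ _).trans ?_
      rw [hL1]
      refine Finset.sum_le_sum fun i _ => ?_
      exact (le_iSup (fun z : V => P {ω | sep G ω z L}) _).trans (hpk (kbar + m) (by omega))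
    refine h1.trans ?_
    rw [Finset.sum_const, Finset.card_range, ← ENNReal.ofReal_nsmul]
    apply ENNReal.ofReal_le_ofReal
    rw [nsmul_eq_mul]
    have hfl := Nat.floor_le (show 0 ≤ L ^ γ by linarith)
    have hpos : 0 < L ^ (-β) := Real.rpow_pos_of_pos (by linarith) _
    have h2 : (2 : ℝ) ^ m ≤ L := by
      have := Lseq_grow hγ hscale kbar m le_rfl
      have h3 := hge kbar
      have h4 : (0 : ℝ) < 2 ^ m := by positivity
      nlinarith
    calc ((⌊L ^ γ⌋₊ + 1 : ℕ) : ℝ) * L ^ (-β) ≤ (2 * L ^ γ) * L ^ (-β) := by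
          apply mul_le_mul_of_nonneg_right _ hpos.le
          push_cast; linarith
      _ = 2 * L ^ (-(β - γ)) := by
          rw [mul_assoc, ← Real.rpow_add (by linarith)]
          congr 2; ring
      _ ≤ 2 * ((2 : ℝ) ^ m) ^ (-(β - γ)) := by
          apply mul_le_mul_of_nonneg_left _ (by norm_num)
          exact Real.rpow_le_rpow_of_nonpos (by positivity) h2 (by linarith)
      _ = 2 * ρ ^ m := by
          rw [hρ, ← Real.rpow_natCast, ← Real.rpow_natCast, ← Real.rpow_mul (by norm_num),
            ← Real.rpow_mul (by norm_num)]
          congr 2; ring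
  have hsum : ∑' m, P (s m) ≠ ⊤ := by
    refine ne_top_of_le_ne_top ?_ (ENNReal.tsum_le_tsum hbound)
    have hsm : Summable fun m : ℕ => 2 * ρ ^ m :=
      (summable_geometric_of_lt_one hρ0.le hρ1).mul_left 2
    exact hsm.tsum_ofReal_ne_top
  have hae : ∀ᵐ ω ∂P, UniqueInfCluster G ω := by
    filter_upwards [ae_eventually_notMem hsum] with ω hω
    obtain ⟨m0, hm0⟩ := eventually_atTop.1 hω
    refine determ hconn hlf hγ hscale x hx0 hx (k0 := kbar + m0) (by omega) ?_
    intro k hk i hi hsep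
    obtain ⟨m, rfl⟩ := Nat.exists_eq_add_of_le (show kbar ≤ k by omega)
    apply hm0 m (by omega)
    simp only [hs, Set.mem_iUnion]
    exact ⟨i, by rw [Finset.mem_range, Nat.lt_succ_iff]; exact Nat.le_floor hi, hsep⟩
  have : {ω | UniqueInfCluster G ω} =ᵐ[P] Set.univ := by
    rw [eventuallyEq_univ]; exact hae
  rw [measure_congr this, measure_univ]
end

section
/- Let G = (V,E) be an infinite, connected, locally finite graph, fix γ > 1 and set L_0 = 10000, L_{k+1} = L_k^γ. Let P be a probability measure on {0,1}^V (with the product σ-algebra) and set p_k = sup_{x ∈ V} P[S(x, L_k)]. Suppose that for some χ > 0, some β > γ(1+χ), and some k̄ ≥ 1 with 2000·L_k < L_{k+1} for all k ≥ k̄, one has p_k ≤ L_k^{−β} for all k ≥ k̄. Then there exists a constant c > 0, depending only on γ, χ and k̄, such that for every x ∈ V and every real L ≥ 1, P[ L ≤ diam(C_x) < ∞ ] ≤ c · L^{−χ}, where C_x denotes the open cluster containing x. -/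
open MeasureTheory Filter

universe u

variable {V : Type u}

namespace S11

theorem mem_gball_iff {V : Type u} {G : SimpleGraph V} (hG : G.Connected) {x y : V} {r : ℝ} :
    y ∈ gball G x r ↔ (G.dist x y : ℝ) ≤ r := by
  constructor
  · rintro ⟨p, hp⟩
    have := SimpleGraph.dist_le p
    have h2 : (G.dist x y : ℝ) ≤ p.length := by exact_mod_cast this
    linarith
  · intro h
    obtain ⟨p, hp⟩ := hG.exists_walk_length_eq_dist x y
    exact ⟨p, by rw [hp]; exact h⟩

theorem distGE_iff {V : Type u} {G : SimpleGraph V} (hG : G.Connected) {x y : V} {r : ℝ} :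
    distGE G x y r ↔ r ≤ (G.dist x y : ℝ) := by
  constructor
  · intro h
    obtain ⟨p, hp⟩ := hG.exists_walk_length_eq_dist x y
    have := h p
    rwa [hp] at this
  · intro h p
    have := SimpleGraph.dist_le p
    have h2 : (G.dist x y : ℝ) ≤ p.length := by exact_mod_cast this
    linarith

theorem connSet_of_walks {V : Type u} {G : SimpleGraph V} {A : Set V} {y : V} (hy : y ∈ A)
    (h : ∀ v ∈ A, ∃ p : G.Walk y v, ∀ u ∈ p.support, u ∈ A) : ConnSet G A := by
  apply SimpleGraph.induce_connected_of_patches y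
  · exact hy
  · intro v hv
    obtain ⟨p, hp⟩ := h v hv
    refine ⟨{u | u ∈ p.support}, hp, p.start_mem_support, p.end_mem_support, ?_⟩
    exact p.connected_induce_support.preconnected _ _

theorem trunc {V : Type u} {G : SimpleGraph V} (hG : G.Connected) (y : V) (r : ℕ) {u z : V}
    (p : G.Walk u z) (hu : G.dist y u ≤ r) (hz : r ≤ G.dist y z) :
    ∃ v, ∃ q : G.Walk u v, (∀ w ∈ q.support, w ∈ p.support ∧ G.dist y w ≤ r) ∧
      G.dist y v = r := by
  induction p with
  | nil => exact ⟨_, SimpleGraph.Walk.nil, by simpa using hu, le_antisymm hu hz⟩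
  | @cons a b c h p ih =>
    by_cases hr : G.dist y a = r
    · exact ⟨_, SimpleGraph.Walk.nil, by simpa using hu, hr⟩
    · have h1 : G.dist y b ≤ G.dist y a + G.dist a b := hG.dist_triangle
      rw [SimpleGraph.dist_eq_one_iff_adj.2 h] at h1
      obtain ⟨v, q, hq, hv⟩ := ih (by omega) hz
      refine ⟨v, SimpleGraph.Walk.cons h q, ?_, hv⟩
      intro w hw
      rw [SimpleGraph.Walk.support_cons, List.mem_cons] at hw ⊢
      rcases hw with rfl | hw
      · exact ⟨Or.inl rfl, hu⟩
      · exact ⟨Or.inr (hq w hw).1, (hq w hw).2⟩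

theorem ray_walk {V : Type u} {G : SimpleGraph V} (f : ℕ → V)
    (hf : ∀ n, G.Adj (f n) (f (n + 1))) (a m : ℕ) :
    ∃ p : G.Walk (f a) (f (a + m)), p.length = m ∧
      ∀ u ∈ p.support, ∃ n, a ≤ n ∧ n ≤ a + m ∧ f n = u := by
  induction m with
  | zero => exact ⟨SimpleGraph.Walk.nil, rfl, by
      intro u hu
      simp at hu
      exact ⟨a, le_rfl, le_rfl, hu.symm⟩⟩
  | succ m ih =>
    obtain ⟨p, hl, hp⟩ := ih
    refine ⟨p.concat (hf (a + m)), by simp [hl], ?_⟩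
    intro u hu
    rw [SimpleGraph.Walk.support_concat] at hu
    simp at hu
    rcases hu with hu | hu
    · obtain ⟨n, h1, h2, h3⟩ := hp u hu
      exact ⟨n, h1, by omega, h3⟩
    · exact ⟨a + m + 1, by omega, by omega, hu.symm⟩

theorem ray_dist {V : Type u} {G : SimpleGraph V} (hG : G.Connected) (x : V) (f : ℕ → V)
    (hf : ∀ n, G.Adj (f n) (f (n + 1))) (hd : ∀ n, G.dist x (f n) = n) (a m : ℕ) :
    G.dist (f a) (f (a + m)) = m := by
  obtain ⟨p, hl, -⟩ := ray_walk f hf a m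
  have h1 := SimpleGraph.dist_le p
  have h2 : G.dist x (f (a + m)) ≤ G.dist x (f a) + G.dist (f a) (f (a + m)) := hG.dist_triangle
  rw [hd, hd] at h2
  omega

theorem exists_ray {V : Type u} (G : SimpleGraph V) [Infinite V] (hG : G.Connected)
    (hfin : ∀ v : V, (G.neighborSet v).Finite) (x : V) :
    ∃ f : ℕ → V, (∀ n, G.Adj (f n) (f (n + 1))) ∧ ∀ n, G.dist x (f n) = n := by
  let D : V → Set V := fun v => {w | G.dist x w = G.dist x v + G.dist v w}
  have key : ∀ v : V, (D v).Infinite →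
      ∃ u, G.Adj v u ∧ G.dist x u = G.dist x v + 1 ∧ (D u).Infinite := by
    intro v hv
    by_contra hcon
    push Not at hcon
    apply hv
    have hsub : D v ⊆ {v} ∪ ⋃ u ∈ {u ∈ G.neighborSet v | G.dist x u = G.dist x v + 1}, D u := by
      intro w hw
      obtain ⟨p, hp⟩ := hG.exists_walk_length_eq_dist v w
      cases p with
      | nil => left; rfl
      | @cons _ u _ h q =>
        right
        have hw' : G.dist x w = G.dist x v + G.dist v w := hw
        have hq := SimpleGraph.dist_le q
        rw [SimpleGraph.Walk.length_cons] at hp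
        have h1 : G.dist x w ≤ G.dist x u + G.dist u w := hG.dist_triangle
        have h2 : G.dist x u ≤ G.dist x v + G.dist v u := hG.dist_triangle
        rw [SimpleGraph.dist_eq_one_iff_adj.2 h] at h2
        simp only [Set.mem_iUnion]
        refine ⟨u, ⟨h, by omega⟩, ?_⟩
        change G.dist x w = G.dist x u + G.dist u w
        omega
    refine Set.Finite.subset ((Set.finite_singleton v).union ?_) hsub
    refine Set.Finite.biUnion ((hfin v).subset (fun u hu => hu.1)) ?_
    intro u hu
    exact hcon u hu.1 hu.2
  have h0 : (D x).Infinite := by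
    have : D x = Set.univ := by
      ext w; simp [D]
    rw [this]; exact Set.infinite_univ
  choose! g hg1 hg2 hg3 using key
  have hD : ∀ n, (D (g^[n] x)).Infinite := by
    intro n
    induction n with
    | zero => exact h0
    | succ n ih => rw [Function.iterate_succ_apply']; exact hg3 _ ih
  refine ⟨fun n => g^[n] x, ?_, ?_⟩
  · intro n
    simp only [Function.iterate_succ_apply']
    exact hg1 _ (hD n)
  · intro n
    induction n with
    | zero => simp
    | succ n ih => 
      simp only [Function.iterate_succ_apply'] at ih ⊢
      rw [hg2 _ (hD n), ih]

theorem dist_le_one_cases {V : Type u} {G : SimpleGraph V} (hG : G.Connected) {v a : V}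
    (h : a ∈ gball G v 1) : v = a ∨ G.Adj v a := by
  rw [mem_gball_iff hG] at h
  have h' : G.dist v a ≤ 1 := by exact_mod_cast h
  rcases Nat.le_one_iff_eq_zero_or_eq_one.1 h' with h | h
  · left; exact hG.dist_eq_zero_iff.1 h
  · right; exact SimpleGraph.dist_eq_one_iff_adj.1 h

theorem step {V : Type u} {G : SimpleGraph V} (hG : G.Connected) (ω : V → Bool) (x : V)
    (f : ℕ → V) (hf : ∀ n, G.Adj (f n) (f (n + 1))) (hd : ∀ n, G.dist x (f n) = n)
    (R : ℝ) (hR : 10000 ≤ R) (i : ℕ) (y z : V) (hy : y ∈ openCluster G ω x)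
    (hz : z ∈ openCluster G ω x) (hyi : G.dist (f i) y ≤ 1) (hyz : R / 50 ≤ (G.dist y z : ℝ))
    (hsep : ¬ sep G ω (f i) R) :
    ∃ j, i < j ∧ ∃ w ∈ openCluster G ω x, G.dist (f j) w ≤ 1 := by
  obtain ⟨r, hr1, hr2⟩ : ∃ r : ℕ, R / 100 ≤ r ∧ (r : ℝ) ≤ R / 100 + 1 :=
    ⟨⌈R / 100⌉₊, Nat.le_ceil _, (Nat.ceil_lt_add_one (by linarith)).le⟩
  obtain ⟨hx, py, hpy⟩ := hy
  obtain ⟨-, pz, hpz⟩ := hz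
  have hrz : r ≤ G.dist y z := by
    have : (r : ℝ) ≤ G.dist y z := by linarith
    exact_mod_cast this
  let A : Set V := {v | ∃ p : G.Walk y v, ∀ u ∈ p.support, ω u = true ∧ G.dist y u ≤ r}
  let B : Set V := {v | ∃ n, i + (r + 3) ≤ n ∧ n ≤ i + (r + 3) + r ∧ f n = v}
  have hyA : y ∈ A := ⟨SimpleGraph.Walk.nil, by
    intro u hu
    simp at hu
    subst hu
    exact ⟨hpy _ py.end_mem_support, by simp⟩⟩
  have hAd : ∀ v ∈ A, G.dist y v ≤ r := by
    rintro v ⟨p, hp⟩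
    exact (hp v p.end_mem_support).2
  have hAi : ∀ v ∈ A, G.dist (f i) v ≤ r + 1 := by
    intro v hv
    have h1 : G.dist (f i) v ≤ G.dist (f i) y + G.dist y v := hG.dist_triangle
    have := hAd v hv
    omega
  have hBi : ∀ v ∈ B, r + 3 ≤ G.dist (f i) v ∧ G.dist (f i) v ≤ 2 * r + 3 := by
    rintro v ⟨n, h1, h2, rfl⟩
    obtain ⟨m, rfl⟩ : ∃ m, n = i + m := ⟨n - i, by omega⟩
    rw [ray_dist hG x f hf hd]
    omega
  have hconn : ConnectsIn G ω A B (gball G (f i) R) := by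
    by_contra hcon
    apply hsep
    refine ⟨A, B, ?_, ?_, ?_, ?_, ?_, ?_, ?_, hcon⟩
    · intro v hv
      rw [mem_gball_iff hG]
      have : (G.dist (f i) v : ℝ) ≤ r + 1 := by exact_mod_cast hAi v hv
      linarith
    · intro v hv
      rw [mem_gball_iff hG]
      have : (G.dist (f i) v : ℝ) ≤ 2 * r + 3 := by exact_mod_cast (hBi v hv).2
      linarith
    · refine connSet_of_walks hyA ?_
      rintro v ⟨p, hp⟩
      refine ⟨p, ?_⟩
      intro u hu
      classical
      exact ⟨p.takeUntil u hu, fun w hw => hp w (p.support_takeUntil_subset hu hw)⟩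
    · refine connSet_of_walks (y := f (i + (r + 3))) ⟨_, le_rfl, by omega, rfl⟩ ?_
      rintro v ⟨n, h1, h2, rfl⟩
      obtain ⟨m, rfl⟩ : ∃ m, n = i + (r + 3) + m := ⟨n - (i + (r + 3)), by omega⟩
      obtain ⟨p, -, hp⟩ := ray_walk f hf (i + (r + 3)) m
      refine ⟨p, fun u hu => ?_⟩
      obtain ⟨n, h3, h4, h5⟩ := hp u hu
      exact ⟨n, h3, by omega, h5⟩
    · intro a ha b hb
      rw [distGE_iff hG]
      have h1 := hAi a ha
      have h2 := (hBi b hb).1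
      have h3 : G.dist (f i) b ≤ G.dist (f i) a + G.dist a b := hG.dist_triangle
      have : 2 ≤ G.dist a b := by omega
      exact_mod_cast this
    · obtain ⟨v, q, hq, hv⟩ := trunc hG y r (py.reverse.append pz) (by simp) hrz
      refine ⟨y, hyA, v, ⟨q, fun u hu => ⟨?_, (hq u hu).2⟩⟩, ?_⟩
      · have := (hq u hu).1
        rw [SimpleGraph.Walk.mem_support_append_iff] at this
        rcases this with h | h
        · rw [SimpleGraph.Walk.support_reverse, List.mem_reverse] at h
          exact hpy u h
        · exact hpz u h
      · rw [distGE_iff hG, hv]; exact hr1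
    · refine ⟨f (i + (r + 3)), ⟨_, le_rfl, by omega, rfl⟩, f (i + (r + 3) + r),
        ⟨_, by omega, le_rfl, rfl⟩, ?_⟩
      rw [distGE_iff hG, ray_dist hG x f hf hd]; exact hr1
  obtain ⟨a, b, p, ⟨v, ⟨q, hq⟩, hav⟩, ⟨w, ⟨n, hn1, hn2, rfl⟩, hbw⟩, -, hp⟩ := hconn
  refine ⟨n, by omega, b, ⟨hx, ?_⟩, ?_⟩
  · rcases dist_le_one_cases hG hav with rfl | hadj
    · refine ⟨(py.append q).append p, ?_⟩
      intro u hu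
      simp only [SimpleGraph.Walk.mem_support_append_iff] at hu
      rcases hu with (h | h) | h
      · exact hpy u h
      · exact (hq u h).1
      · exact hp u h
    · refine ⟨(py.append q).append (SimpleGraph.Walk.cons hadj p), ?_⟩
      intro u hu
      simp only [SimpleGraph.Walk.mem_support_append_iff, SimpleGraph.Walk.support_cons,
        List.mem_cons] at hu
      rcases hu with (h | h) | h | h
      · exact hpy u h
      · exact (hq u h).1
      · subst h; exact (hq _ q.end_mem_support).1
      · exact hp u h
  · rw [mem_gball_iff hG] at hbw
    exact_mod_cast hbw

theorem exists_sep {V : Type u} {G : SimpleGraph V} (hG : G.Connected) (ω : V → Bool) (x : V)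
    (f : ℕ → V) (hf : ∀ n, G.Adj (f n) (f (n + 1))) (hd : ∀ n, G.dist x (f n) = n)
    (S : ℕ → ℝ) (hS : ∀ n, 10000 ≤ S n) (hS2 : ∀ i : ℕ, ∃ n, (i : ℝ) < S (n + 1))
    (L : ℝ) (hL : S 0 ≤ L)
    (hdiam : diamGE G (openCluster G ω x) L) (hfin : (openCluster G ω x).Finite) :
    ∃ m i : ℕ, (i : ℝ) < S (m + 1) ∧ sep G ω (f i) (S m) := by
  by_contra hcon
  push Not at hcon
  have h0 := hS 0
  obtain ⟨a, ha, b, hb, hab⟩ := hdiam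
  rw [distGE_iff hG] at hab
  have hx : x ∈ openCluster G ω x := ⟨ha.1, SimpleGraph.Walk.nil, by simpa using ha.1⟩
  have hstep : ∀ i, (∃ w ∈ openCluster G ω x, G.dist (f i) w ≤ 1) →
      ∃ j, i < j ∧ ∃ w ∈ openCluster G ω x, G.dist (f j) w ≤ 1 := by
    rintro i ⟨y, hy, hyi⟩
    classical
    by_cases hi : (i : ℝ) < S 1
    · have hi' := hcon 0 i hi
      have htri : G.dist a b ≤ G.dist y a + G.dist y b := by
        rw [SimpleGraph.dist_comm (u := y) (v := a)]; exact hG.dist_triangle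
      have htri' : (G.dist a b : ℝ) ≤ G.dist y a + G.dist y b := by exact_mod_cast htri
      by_cases hya : S 0 / 50 ≤ (G.dist y a : ℝ)
      · exact step hG ω x f hf hd (S 0) h0 i y a hy ha hyi hya hi'
      · exact step hG ω x f hf hd (S 0) h0 i y b hy hb hyi (by linarith) hi'
    · have hfind := Nat.find_spec (hS2 i)
      have hmin : ∀ n, n < Nat.find (hS2 i) → S (n + 1) ≤ i :=
        fun n hn => not_lt.1 (Nat.find_min (hS2 i) hn)
      generalize Nat.find (hS2 i) = N at hfind hmin
      have key : ∀ m, (i : ℝ) < S (m + 1) → S m ≤ i →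
          ∃ j, i < j ∧ ∃ w ∈ openCluster G ω x, G.dist (f j) w ≤ 1 := by
        intro m h1 h2
        refine step hG ω x f hf hd (S m) (hS m) i y x hy hx hyi ?_ (hcon m i h1)
        have htri : G.dist x (f i) ≤ G.dist y x + G.dist (f i) y := by
          rw [SimpleGraph.dist_comm (u := y) (v := x), SimpleGraph.dist_comm (u := f i) (v := y)]
          exact hG.dist_triangle
        rw [hd] at htri
        have : (i : ℝ) ≤ G.dist y x + 1 := by
          have : i ≤ G.dist y x + 1 := by omega
          exact_mod_cast this
        have := hS m
        linarith
      cases N with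
      | succ m => exact key (m + 1) hfind (hmin m (by omega))
      | zero => exact absurd hfind hi
  have hall : ∀ n : ℕ, ∃ j, n ≤ j ∧ ∃ w ∈ openCluster G ω x, G.dist (f j) w ≤ 1 := by
    intro n
    induction n with
    | zero =>
      refine ⟨0, le_rfl, x, hx, ?_⟩
      rw [SimpleGraph.dist_comm, hd]; omega
    | succ n ih =>
      obtain ⟨j, hj, h⟩ := ih
      obtain ⟨j', hj', h'⟩ := hstep j h
      exact ⟨j', by omega, h'⟩
  obtain ⟨M, hM⟩ := (hfin.image (fun w => G.dist x w)).bddAbove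
  obtain ⟨j, hj, w, hw, hjw⟩ := hall (M + 2)
  have h1 : G.dist x w ≤ M := hM ⟨w, hw, rfl⟩
  have h2 : G.dist x (f j) ≤ G.dist x w + G.dist (f j) w := by
    rw [SimpleGraph.dist_comm (u := f j) (v := w)]
    exact hG.dist_triangle
  rw [hd] at h2
  omega

theorem Lseq_ge (γ : ℝ) (hγ : 1 < γ) (k : ℕ) : 10000 ≤ Lseq γ k := by
  induction k with
  | zero => simp [Lseq]
  | succ k ih =>
    have h : Lseq γ k ^ (1 : ℝ) ≤ Lseq γ k ^ γ :=
      Real.rpow_le_rpow_of_exponent_le (by linarith) hγ.le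
    rw [Real.rpow_one] at h
    exact ih.trans h

theorem Lseq_geom (γ : ℝ) (kbar : ℕ)
    (h : ∀ k, kbar ≤ k → 2000 * Lseq γ k < Lseq γ (k + 1)) (k : ℕ) (hk : kbar ≤ k) (m : ℕ) :
    2000 ^ m * Lseq γ k ≤ Lseq γ (k + m) := by
  induction m with
  | zero => simp
  | succ m ih =>
    have := h (k + m) (by omega)
    rw [pow_succ, ← add_assoc]
    linarith

theorem Lseq_unb (γ : ℝ) (hγ : 1 < γ) (kbar : ℕ)
    (h : ∀ k, kbar ≤ k → 2000 * Lseq γ k < Lseq γ (k + 1)) (k : ℕ) (hk : kbar ≤ k) (L : ℝ) :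
    ∃ m, L < Lseq γ (k + m) := by
  obtain ⟨m, hm⟩ := pow_unbounded_of_one_lt L (by norm_num : (1 : ℝ) < 2000)
  refine ⟨m, ?_⟩
  have h1 := Lseq_geom γ kbar h k hk m
  have h2 := Lseq_ge γ hγ k
  have h3 : (0 : ℝ) < 2000 ^ m := by positivity
  nlinarith

/-- Term bound. -/
theorem term_bound (γ χ β : ℝ) (kbar : ℕ) (hγ : 1 < γ) (hχ : 0 < χ) (hβ : γ * (1 + χ) < β)
    (h : ∀ k, kbar ≤ k → 2000 * Lseq γ k < Lseq γ (k + 1)) (k : ℕ) (hk : kbar ≤ k)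
    (L : ℝ) (hL : 0 < L) (hLk : L ≤ Lseq γ (k + 1)) (m : ℕ) :
    (⌈Lseq γ (k + m + 1)⌉₊ : ℝ) * Lseq γ (k + m) ^ (-β) ≤
      2 * L ^ (-χ) * ((2000 : ℝ) ^ (-χ)) ^ m := by
  have hA := Lseq_ge γ hγ (k + m)
  have hB := Lseq_ge γ hγ (k + m + 1)
  have hc : (⌈Lseq γ (k + m + 1)⌉₊ : ℝ) ≤ 2 * Lseq γ (k + m + 1) := by
    have := (Nat.ceil_lt_add_one (a := Lseq γ (k + m + 1)) (by linarith)).le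
    linarith
  have hpos : 0 < Lseq γ (k + m) := by linarith
  have h1 : Lseq γ (k + m + 1) * Lseq γ (k + m) ^ (-β) ≤ Lseq γ (k + m + 1) ^ (-χ) := by
    change Lseq γ (k + m) ^ γ * Lseq γ (k + m) ^ (-β) ≤ (Lseq γ (k + m) ^ γ) ^ (-χ)
    rw [← Real.rpow_add hpos, ← Real.rpow_mul hpos.le]
    exact Real.rpow_le_rpow_of_exponent_le (by linarith) (by linarith)
  have h2 : 2000 ^ m * L ≤ Lseq γ (k + m + 1) := by
    have := Lseq_geom γ kbar h (k + 1) (by omega) m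
    rw [show k + 1 + m = k + m + 1 by omega] at this
    exact le_trans (by gcongr) this
  have h3 : Lseq γ (k + m + 1) ^ (-χ) ≤ (2000 ^ m * L) ^ (-χ) :=
    Real.rpow_le_rpow_of_nonpos (by positivity) h2 (by linarith)
  have h4 : ((2000 : ℝ) ^ m * L) ^ (-χ) = L ^ (-χ) * ((2000 : ℝ) ^ (-χ)) ^ m := by
    rw [Real.mul_rpow (by positivity) hL.le, ← Real.rpow_natCast, ← Real.rpow_mul (by norm_num),
      ← Real.rpow_natCast, ← Real.rpow_mul (by norm_num), mul_comm (m : ℝ), mul_comm]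
  have h5 : 0 ≤ Lseq γ (k + m) ^ (-β) := by positivity
  calc _ ≤ 2 * Lseq γ (k + m + 1) * Lseq γ (k + m) ^ (-β) := by gcongr
    _ ≤ _ := by rw [h4] at h3; linarith

end S11

/-- if the probabilities of the separation events decay like
`p_k ≤ L_k^{-β}` with `β > γ(1+χ)`, then `P[L ≤ diam(C_x) < ∞] ≤ c L^{-χ}` with a
constant `c` depending only on `γ, χ, k̄`. -/
theorem statement11 :
    ∀ (γ χ : ℝ) (kbar : ℕ), 1 < γ → 0 < χ → 1 ≤ kbar →
    ∃ c : ℝ, 0 < c ∧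
      ∀ (V : Type u) (G : SimpleGraph V), Infinite V → G.Connected →
        (∀ v : V, (G.neighborSet v).Finite) →
        ∀ (P : Measure (V → Bool)), IsProbabilityMeasure P →
        ∀ β : ℝ, γ * (1 + χ) < β →
        (∀ k, kbar ≤ k → 2000 * Lseq γ k < Lseq γ (k + 1)) →
        (∀ k, kbar ≤ k →
          ⨆ x : V, P {ω | sep G ω x (Lseq γ k)} ≤ ENNReal.ofReal (Lseq γ k ^ (-β))) →
        ∀ (x : V) (L : ℝ), 1 ≤ L →
          (P {ω | diamGE G (openCluster G ω x) L ∧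
            (openCluster G ω x).Finite}).toReal ≤ c * L ^ (-χ) := by
  intro γ χ kbar hγ hχ hkbar
  have hr0 : (0 : ℝ) ≤ (2000 : ℝ) ^ (-χ) := by positivity
  have hr1 : (2000 : ℝ) ^ (-χ) < 1 :=
    Real.rpow_lt_one_of_one_lt_of_neg (by norm_num) (by linarith)
  set r : ℝ := (2000 : ℝ) ^ (-χ) with hr
  refine ⟨max (Lseq γ kbar ^ χ) (2 * (1 - r)⁻¹), ?_, ?_⟩
  · apply lt_max_of_lt_right
    have : 0 < 1 - r := by linarith
    positivity
  intro V G hinf hG hfin P hP β hβ hgrow hsep x L hL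
  have hL0 : 0 < L := by linarith
  have hLχ : 0 < L ^ (-χ) := by positivity
  have hK := S11.Lseq_ge γ hγ kbar
  by_cases hLk : L < Lseq γ kbar
  · have h1 : (P {ω | diamGE G (openCluster G ω x) L ∧
            (openCluster G ω x).Finite}).toReal ≤ 1 := by
      have := measureReal_le_one (μ := P) (s := {ω | diamGE G (openCluster G ω x) L ∧
            (openCluster G ω x).Finite})
      exact this
    have h2 : 1 ≤ Lseq γ kbar ^ χ * L ^ (-χ) := by
      have h3 : L ^ χ ≤ Lseq γ kbar ^ χ := Real.rpow_le_rpow hL0.le hLk.le hχ.le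
      have h4 : L ^ χ * L ^ (-χ) = 1 := by
        rw [← Real.rpow_add hL0]; simp
      rw [← h4]
      gcongr
    have h5 : Lseq γ kbar ^ χ * L ^ (-χ) ≤ max (Lseq γ kbar ^ χ) (2 * (1 - r)⁻¹) * L ^ (-χ) :=
      mul_le_mul_of_nonneg_right (le_max_left _ _) hLχ.le
    linarith
  · obtain ⟨k, hk, hk1, hk2⟩ : ∃ k, kbar ≤ k ∧ Lseq γ k ≤ L ∧ L < Lseq γ (k + 1) := by
      classical
      have hex := S11.Lseq_unb γ hγ kbar hgrow kbar le_rfl L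
      have hs := Nat.find_spec hex
      have hm : ∀ n, n < Nat.find hex → ¬ _ := fun n hn => Nat.find_min hex hn
      generalize Nat.find hex = N at hs hm
      cases N with
      | zero => exact absurd hs hLk
      | succ n => exact ⟨kbar + n, by omega, not_lt.1 (hm n (by omega)), hs⟩
    obtain ⟨f, hf, hd⟩ := S11.exists_ray G hG hfin x
    have hsub : {ω | diamGE G (openCluster G ω x) L ∧ (openCluster G ω x).Finite} ⊆
        ⋃ m : ℕ, ⋃ i ∈ Finset.range ⌈Lseq γ (k + m + 1)⌉₊,
          {ω | sep G ω (f i) (Lseq γ (k + m))} := by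
      rintro ω ⟨h1, h2⟩
      obtain ⟨m, i, him, hs⟩ := S11.exists_sep hG ω x f hf hd (fun m => Lseq γ (k + m))
        (fun m => S11.Lseq_ge γ hγ _) (fun i => by
          obtain ⟨m, hm⟩ := S11.Lseq_unb γ hγ kbar hgrow (k + 1) (by omega) i
          exact ⟨m, by rwa [show k + (m + 1) = k + 1 + m by omega]⟩) L hk1 h1 h2
      simp only [Set.mem_iUnion]
      exact ⟨m, i, Finset.mem_range.2 (Nat.lt_ceil.2 him), hs⟩
    have hterm : ∀ m : ℕ, P (⋃ i ∈ Finset.range ⌈Lseq γ (k + m + 1)⌉₊,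
          {ω | sep G ω (f i) (Lseq γ (k + m))}) ≤ ENNReal.ofReal (2 * L ^ (-χ) * r ^ m) := by
      intro m
      have hone : ∀ i, P {ω | sep G ω (f i) (Lseq γ (k + m))} ≤
          ENNReal.ofReal (Lseq γ (k + m) ^ (-β)) := fun i =>
        (le_iSup (fun y => P {ω | sep G ω y (Lseq γ (k + m))}) (f i)).trans
          (hsep (k + m) (by omega))
      calc _ ≤ ∑ i ∈ Finset.range ⌈Lseq γ (k + m + 1)⌉₊,
              P {ω | sep G ω (f i) (Lseq γ (k + m))} := measure_biUnion_finset_le _ _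
        _ ≤ ∑ i ∈ Finset.range ⌈Lseq γ (k + m + 1)⌉₊,
              ENNReal.ofReal (Lseq γ (k + m) ^ (-β)) := Finset.sum_le_sum fun i _ => hone i
        _ = ENNReal.ofReal ((⌈Lseq γ (k + m + 1)⌉₊ : ℝ) * Lseq γ (k + m) ^ (-β)) := by
          rw [Finset.sum_const, Finset.card_range, nsmul_eq_mul,
            ENNReal.ofReal_mul (by positivity), ENNReal.ofReal_natCast]
        _ ≤ _ := ENNReal.ofReal_le_ofReal
          (S11.term_bound γ χ β kbar hγ hχ hβ hgrow k hk L hL0 hk2.le m)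
    have hgeo : HasSum (fun m : ℕ => 2 * L ^ (-χ) * r ^ m) (2 * L ^ (-χ) * (1 - r)⁻¹) :=
      (hasSum_geometric_of_lt_one hr0 hr1).mul_left _
    have htot : P {ω | diamGE G (openCluster G ω x) L ∧ (openCluster G ω x).Finite} ≤
        ENNReal.ofReal (2 * L ^ (-χ) * (1 - r)⁻¹) := by
      refine (measure_mono hsub).trans ((measure_iUnion_le _).trans
        ((ENNReal.tsum_le_tsum hterm).trans ?_))
      rw [← ENNReal.ofReal_tsum_of_nonneg (fun m => by positivity) hgeo.summable, hgeo.tsum_eq]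
    have hinv : 0 ≤ (1 - r)⁻¹ := inv_nonneg.2 (by linarith)
    have h6 := ENNReal.toReal_le_of_le_ofReal (by positivity) htot
    have h5 : 2 * (1 - r)⁻¹ * L ^ (-χ) ≤ max (Lseq γ kbar ^ χ) (2 * (1 - r)⁻¹) * L ^ (-χ) :=
      mul_le_mul_of_nonneg_right (le_max_right _ _) hLχ.le
    linarith
end

section
/- Let G = (V,E) be a graph, let x ∈ V, let L ≥ 10000 be a real number, and let ω : V → {0,1} be a configuration. Suppose A, B ⊆ B(x, 3L/6) are connected sets with d(A,B) > 1, each of diameter at least L/100, such that no open path with all vertices in B(x, L) connects A to B. Then there exist connected sets A' ⊆ A and B' ⊆ B, both contained in B(x, 3L/6), each of diameter at least L/1000, with d(A',B') ≥ L/750, and such that no open path with all vertices in B(x, L) connects A' to B'. -/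
open MeasureTheory Filter

universe u

variable {V : Type u}

theorem grow17 {V : Type u} (G : SimpleGraph V) (A : Set V) (y : V) (s : ℝ)
    (u z : A) (w : (G.induce A).Walk u z) (hz : distGE G y z.1 s) :
    ∀ C : Set V, C ⊆ A → (G.induce C).Connected → y ∈ C → u.1 ∈ C → C ⊆ gball G y (s + 1) →
    ∃ A' : Set V, A' ⊆ A ∧ ConnSet G A' ∧ y ∈ A' ∧ A' ⊆ gball G y (s + 1) ∧
      ∃ z' ∈ A', distGE G y z' s := by
  induction w with
  | nil =>
    intro C hCA hC hy hu hb
    exact ⟨C, hCA, hC, hy, hb, _, hu, hz⟩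
  | @cons u v z h w ih =>
    intro C hCA hC hy hu hb
    by_cases hd : distGE G y u.1 s
    · exact ⟨C, hCA, hC, hy, hb, _, hu, hd⟩
    · have hadj : G.Adj u.1 v.1 := h
      simp only [distGE, not_forall, not_le] at hd
      obtain ⟨p, hp⟩ := hd
      refine ih hz (C ∪ {u.1, v.1}) ?_ ?_ (Or.inl hy) (Or.inr (Or.inr rfl)) ?_
      · rintro a (ha | rfl | rfl)
        · exact hCA ha
        · exact u.2
        · exact v.2
      · exact SimpleGraph.induce_union_connected hC.preconnected
          (SimpleGraph.induce_pair_connected_of_adj hadj).preconnected ⟨u.1, hu, Or.inl rfl⟩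
      · rintro a (ha | rfl | rfl)
        · exact hb ha
        · exact hb hu
        · refine ⟨p.concat hadj, ?_⟩
          rw [SimpleGraph.Walk.length_concat]
          push_cast
          linarith

theorem grow17' {V : Type u} (G : SimpleGraph V) (A : Set V) (hA : ConnSet G A) (y z : V)
    (hy : y ∈ A) (hz : z ∈ A) (s : ℝ) (hs : 0 ≤ s) (hd : distGE G y z s) :
    ∃ A' : Set V, A' ⊆ A ∧ ConnSet G A' ∧ y ∈ A' ∧ A' ⊆ gball G y (s + 1) ∧
      ∃ z' ∈ A', distGE G y z' s := by
  obtain ⟨w⟩ := hA.preconnected ⟨y, hy⟩ ⟨z, hz⟩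
  refine grow17 G A y s _ _ w hd {y} (by simpa using hy) ?_ rfl rfl ?_
  · have : Nonempty ({y} : Set V) := ⟨⟨y, rfl⟩⟩
    exact ⟨SimpleGraph.Preconnected.of_subsingleton⟩
  · rintro a rfl
    exact ⟨SimpleGraph.Walk.nil, by simp; linarith⟩

/-- from a separating pair `A, B` one can extract well-separated connected
subsets `A' ⊆ A`, `B' ⊆ B` of diameter at least `L/1000` with `d(A',B') ≥ L/750`, still
not connected by any open path in `B(x,L)`. -/
theorem statement17 {V : Type u} (G : SimpleGraph V) (x : V) (L : ℝ) (hL : 10000 ≤ L)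
    (ω : V → Bool) (A B : Set V)
    (hAb : A ⊆ gball G x (3 * L / 6)) (hBb : B ⊆ gball G x (3 * L / 6))
    (hAc : ConnSet G A) (hBc : ConnSet G B) (hfar : setDistGE G A B 2)
    (hAd : diamGE G A (L / 100)) (hBd : diamGE G B (L / 100))
    (hno : ¬ ConnectsIn G ω A B (gball G x L)) :
    ∃ A' B' : Set V, A' ⊆ A ∧ B' ⊆ B ∧
      A' ⊆ gball G x (3 * L / 6) ∧ B' ⊆ gball G x (3 * L / 6) ∧
      ConnSet G A' ∧ ConnSet G B' ∧
      diamGE G A' (L / 1000) ∧ diamGE G B' (L / 1000) ∧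
      setDistGE G A' B' (L / 750) ∧
      ¬ ConnectsIn G ω A' B' (gball G x L) := by
  obtain ⟨y, hy, z, hz, hyz⟩ := hAd
  obtain ⟨A', hA'A, hA'c, hyA', hA'b, z', hz', hyz'⟩ := grow17' G A hAc y z hy hz (L / 1000)
    (by linarith) (fun p => by have := hyz p; linarith)
  have key : ∃ b ∈ B, ∃ c ∈ B, distGE G b c (L / 100) ∧ distGE G y b (L / 200) := by
    obtain ⟨b, hb, c, hc, hbc⟩ := hBd
    by_cases h1 : distGE G y b (L / 200)
    · exact ⟨b, hb, c, hc, hbc, h1⟩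
    · refine ⟨c, hc, b, hb, fun p => by simpa using hbc p.reverse, fun q => ?_⟩
      simp only [distGE, not_forall, not_le] at h1
      obtain ⟨p, hp⟩ := h1
      have := hbc (p.reverse.append q)
      simp only [SimpleGraph.Walk.length_append, SimpleGraph.Walk.length_reverse] at this
      push_cast at this
      linarith
  obtain ⟨b, hb, c, hc, hbc, hyb⟩ := key
  obtain ⟨B', hB'B, hB'c, hbB', hB'b, c', hc', hbc'⟩ := grow17' G B hBc b c hb hc (L / 1000)
    (by linarith) (fun p => by have := hbc p; linarith)
  refine ⟨A', B', hA'A, hB'B, hA'A.trans hAb, hB'B.trans hBb, hA'c, hB'c,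
    ⟨y, hyA', z', hz', hyz'⟩, ⟨b, hbB', c', hc', hbc'⟩, ?_, ?_⟩
  · intro a ha d hd p
    obtain ⟨q, hq⟩ := hA'b ha
    obtain ⟨r, hr⟩ := hB'b hd
    have := hyb ((q.append p).append r.reverse)
    simp only [SimpleGraph.Walk.length_append, SimpleGraph.Walk.length_reverse] at this
    push_cast at this
    linarith
  · rintro ⟨a, d, p, ⟨a0, ha0, ha⟩, ⟨d0, hd0, hd⟩, h1, h2⟩
    exact hno ⟨a, d, p, ⟨a0, hA'A ha0, ha⟩, ⟨d0, hB'B hd0, hd⟩, h1, h2⟩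
end
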